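/- arXiv:1101.2777 — 5 statements merged into one kernel-verified Lean document; each statement's English description precedes it below -/
import Mathlib

section
/- For any set R with at least 2 elements, any sets n, m, J, any injection of m into the set of maps J → R, and any map f : m → ((n → R) → R), there exist a map f̂ : ((n + J) → R) → R and a function u : (n + J) × m → n + R such that for every i ∈ m and every k : n → R, f(i)(k) = f̂(λx. case u(x,i) of inl y ↦ k(y) | inr r ↦ r). Concretely, identifying m with a subset of R^J, one may take f̂(c) = f(λj. c(inr j))(λa. c(inl a)) and u(x,i) = case x of inl y ↦ inl y | inr j ↦ inr i(j). -/
/-- For any set `R` with at least 2 elements, any sets `n`, `m`, `J`,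
any injection `ι` of `m` into the maps `J → R`, and any map `f : m → ((n → R) → R)`,
there exist `f̂ : ((n + J) → R) → R` and `u : (n + J) × m → n + R` such that for every
`i ∈ m` and `k : n → R`,
`f i k = f̂ (λ x. case u (x, i) of inl y ↦ k y | inr r ↦ r)`;
concretely, the witnesses may be chosen so that
`u (x, i) = case x of inl y ↦ inl y | inr j ↦ inr (ι i j)` and
`f̂ c = f i (λ a. c (inl a))` whenever `(λ j. c (inr j)) = ι i`. -/
theorem cont_generic_morphism (R n m J : Type) (hR : ∃ r₁ r₂ : R, r₁ ≠ r₂)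
    (ι : m → J → R) (hι : Function.Injective ι) (f : m → (n → R) → R) :
    ∃ (fhat : (n ⊕ J → R) → R) (u : (n ⊕ J) × m → n ⊕ R),
      (∀ (i : m) (k : n → R),
        f i k = fhat (fun x => match u (x, i) with
          | Sum.inl y => k y
          | Sum.inr r => r)) ∧
      (∀ (i : m) (y : n), u (Sum.inl y, i) = Sum.inl y) ∧
      (∀ (i : m) (j : J), u (Sum.inr j, i) = Sum.inr (ι i j)) ∧
      (∀ (i : m) (c : n ⊕ J → R), (fun j => c (Sum.inr j)) = ι i →
        fhat c = f i (fun a => c (Sum.inl a))) := by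
  obtain ⟨r₀, -, -⟩ := hR
  have key (i : m) (c : n ⊕ J → R) (hc : (fun j => c (Sum.inr j)) = ι i) :
      Function.extend ι f (fun _ _ => r₀) (fun j => c (Sum.inr j)) (fun a => c (Sum.inl a)) =
        f i (fun a => c (Sum.inl a)) := by
    rw [hc, hι.extend_apply]
  refine ⟨fun c => Function.extend ι f (fun _ _ => r₀)
      (fun j => c (Sum.inr j)) (fun a => c (Sum.inl a)),
    fun p => p.1.elim Sum.inl (fun j => Sum.inr (ι p.2 j)),
    fun i k => ?_, fun _ _ => rfl, fun _ _ => rfl, key⟩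
  exact (key i (Sum.elim k (ι i)) rfl).symm
end

section
/- Let T be a completely additive monad on Set, A a set, b : A → 2 and p : A → T A. Then the map Φ on functions A → T A defined by Φ(q)(x) = if b(x) then (p(x) >>= q) else ret x has a least fixed point with respect to the pointwise induced order, given by w(x) = star(ret x, λx'. (b x')? >>= λ_. p x') >>= λx'. ((¬(b x'))? >>= λ_. ret x'). -/
/-! ### Additive monads on Set and the computational metalanguage -/

/-- A finitely additive monad on `Set`: a monad together with a join-semilattice-with-⊥
structure on each `T A` such that binding distributes over `+` and `⊥` on both sides. -/
structure FinAddMonad where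
  T : Type → Type
  ret : {A : Type} → A → T A
  bind : {A B : Type} → T A → (A → T B) → T B
  bind_ret : ∀ {A B : Type} (a : A) (f : A → T B), bind (ret a) f = f a
  ret_bind : ∀ {A : Type} (p : T A), bind p ret = p
  bind_assoc : ∀ {A B C : Type} (p : T A) (f : A → T B) (g : B → T C),
    bind (bind p f) g = bind p (fun x => bind (f x) g)
  join : {A : Type} → T A → T A → T A
  bot : {A : Type} → T A
  join_comm : ∀ {A : Type} (p q : T A), join p q = join q p
  join_assoc : ∀ {A : Type} (p q r : T A), join (join p q) r = join p (join q r)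
  join_idem : ∀ {A : Type} (p : T A), join p p = p
  bot_join : ∀ {A : Type} (p : T A), join bot p = p
  join_bind : ∀ {A B : Type} (p q : T A) (f : A → T B),
    bind (join p q) f = join (bind p f) (bind q f)
  bind_join : ∀ {A B : Type} (p : T A) (f g : A → T B),
    bind p (fun x => join (f x) (g x)) = join (bind p f) (bind p g)
  bot_bind : ∀ {A B : Type} (f : A → T B), bind bot f = bot
  bind_bot : ∀ {A B : Type} (p : T A), bind p (fun _ => (bot : T B)) = bot

/-- the test operator `b? : T 1` of `b : 2 = 1 + 1`: `ret ⋆` on `inl ⋆` and `⊥` on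
`inr ⋆`. -/
def FinAddMonad.test (M : FinAddMonad) (b : Unit ⊕ Unit) : M.T Unit :=
  match b with
  | Sum.inl _ => M.ret ()
  | Sum.inr _ => M.bot

/-- A completely additive monad on `Set`: a monad with a complete-join-semilattice
structure on each `T A` (arbitrary joins `⨆`, bottom `⨆ ∅`) such that binding
distributes over arbitrary joins and `⊥` on both sides. -/
structure CompAddMonad where
  T : Type → Type
  ret : {A : Type} → A → T A
  bind : {A B : Type} → T A → (A → T B) → T B
  bind_ret : ∀ {A B : Type} (a : A) (f : A → T B), bind (ret a) f = f a
  ret_bind : ∀ {A : Type} (p : T A), bind p ret = p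
  bind_assoc : ∀ {A B C : Type} (p : T A) (f : A → T B) (g : B → T C),
    bind (bind p f) g = bind p (fun x => bind (f x) g)
  le : {A : Type} → T A → T A → Prop
  le_refl : ∀ {A : Type} (p : T A), le p p
  le_trans : ∀ {A : Type} {p q r : T A}, le p q → le q r → le p r
  le_antisymm : ∀ {A : Type} {p q : T A}, le p q → le q p → p = q
  sSup : {A : Type} → Set (T A) → T A
  le_sSup : ∀ {A : Type} (S : Set (T A)) (p : T A), p ∈ S → le p (sSup S)
  sSup_le : ∀ {A : Type} (S : Set (T A)) (q : T A), (∀ p ∈ S, le p q) → le (sSup S) q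
  /-- the induced order agrees with the algebraic one: `p ≤ q` iff `p + q = q`. -/
  le_iff : ∀ {A : Type} (p q : T A), le p q ↔ sSup {p, q} = q
  sSup_bind : ∀ {A B : Type} (S : Set (T A)) (f : A → T B),
    bind (sSup S) f = sSup {x | ∃ p ∈ S, x = bind p f}
  bind_sSup : ∀ {ι A B : Type} (p : T A) (f : ι → A → T B),
    bind p (fun x => sSup (Set.range (fun i => f i x)))
      = sSup (Set.range (fun i => bind p (f i)))
  bot_bind : ∀ {A B : Type} (f : A → T B), bind (sSup ∅) f = sSup ∅
  bind_bot : ∀ {A B : Type} (p : T A), bind p (fun _ => sSup (∅ : Set (T B))) = sSup ∅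

namespace CompAddMonad

variable (M : CompAddMonad)

/-- bottom `⊥ = ⨆ ∅`. -/
def bot {A : Type} : M.T A := M.sSup ∅

/-- binary join. -/
def join {A : Type} (p q : M.T A) : M.T A := M.sSup {p, q}

/-- the test operator `b? : T 1`. -/
def test (b : Unit ⊕ Unit) : M.T Unit :=
  match b with
  | Sum.inl _ => M.ret ()
  | Sum.inr _ => M.bot

/-- the `n`-fold iteration `p >>= q >>= ⋯ >>= q`. -/
def iter {A : Type} (p : M.T A) (q : A → M.T A) : ℕ → M.T A
  | 0 => p
  | n + 1 => M.bind (iter p q n) q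

/-- Kleene star: `star(p,q)` is the join of `p` and all finite iterations
`p >>= q >>= ⋯ >>= q`. -/
def star {A : Type} (p : M.T A) (q : A → M.T A) : M.T A :=
  M.sSup (Set.range (M.iter p q))

end CompAddMonad

namespace CompAddMonad

theorem bot_le (M : CompAddMonad) {A : Type} (p : M.T A) : M.le M.bot p :=
  M.sSup_le _ _ fun _ h => h.elim

theorem sSup_range_bind (M : CompAddMonad) {ι A B : Type} (r : ι → M.T A) (f : A → M.T B) :
    M.bind (M.sSup (Set.range r)) f = M.sSup (Set.range fun i => M.bind (r i) f) := by
  rw [M.sSup_bind]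
  congr 1
  ext y
  simp [eq_comm]

theorem bind_mono (M : CompAddMonad) {A B : Type} (r : M.T A) {f g : A → M.T B}
    (h : ∀ x, M.le (f x) (g x)) : M.le (M.bind r f) (M.bind r g) := by
  have hg : (fun x => M.sSup (Set.range fun i : Bool => (cond i f g) x)) = g := by
    funext x
    refine M.le_antisymm (M.sSup_le _ _ ?_) (M.le_sSup _ _ ⟨false, rfl⟩)
    rintro _ ⟨_ | _, rfl⟩
    · exact M.le_refl _
    · exact h x
  have hb := M.bind_sSup r fun i : Bool => cond i f g
  rw [hg] at hb
  rw [hb]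
  exact M.le_sSup _ _ ⟨true, rfl⟩

theorem iter_bind (M : CompAddMonad) {A B : Type} (r : M.T B) (f : B → M.T A)
    (g : A → M.T A) (n : ℕ) :
    M.iter (M.bind r f) g n = M.bind r fun x => M.iter (f x) g n := by
  induction n with
  | zero => rfl
  | succ n ih => simp only [iter, ih, M.bind_assoc]

theorem iter_succ (M : CompAddMonad) {A : Type} (r : M.T A) (g : A → M.T A) (n : ℕ) :
    M.iter r g (n + 1) = M.iter (M.bind r g) g n := by
  induction n with
  | zero => rfl
  | succ n ih => rw [iter, ih, iter]

theorem iter_ret_succ (M : CompAddMonad) {A : Type} (x : A) (g : A → M.T A) (n : ℕ) :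
    M.iter (M.ret x) g (n + 1) = M.bind (g x) fun y => M.iter (M.ret y) g n := by
  rw [iter_succ, M.bind_ret, ← iter_bind, M.ret_bind]

/-- The part of a while loop that exits after exactly `n` executions of its body. -/
def whileStep (M : CompAddMonad) {A : Type} (b : A → Unit ⊕ Unit) (p : A → M.T A)
    (n : ℕ) (x : A) : M.T A :=
  M.bind (M.iter (M.ret x) (fun y => M.bind (M.test (b y)) fun _ => p y) n)
    fun y => M.bind (M.test (b y).swap) fun _ => M.ret y

variable (M : CompAddMonad) {A : Type} {b : A → Unit ⊕ Unit} (p : A → M.T A) {x : A} {u : Unit}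

theorem whileStep_zero_inl (hb : b x = Sum.inl u) : M.whileStep b p 0 x = M.bot := by
  simp only [whileStep, iter, M.bind_ret, hb, Sum.swap_inl, test]
  exact M.bot_bind _

theorem whileStep_zero_inr (hb : b x = Sum.inr u) : M.whileStep b p 0 x = M.ret x := by
  simp only [whileStep, iter, M.bind_ret, hb, Sum.swap_inr, test]

theorem whileStep_succ_inl (hb : b x = Sum.inl u) (n : ℕ) :
    M.whileStep b p (n + 1) x = M.bind (p x) (M.whileStep b p n) := by
  simp only [whileStep, iter_ret_succ, hb, test, M.bind_ret, M.bind_assoc]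
  rfl

theorem whileStep_succ_inr (hb : b x = Sum.inr u) (n : ℕ) :
    M.whileStep b p (n + 1) x = M.bot := by
  simp only [whileStep, iter_ret_succ, hb, test, M.bind_assoc]
  exact M.bot_bind _

end CompAddMonad

/-- **Statement 8.** Let `T` be a completely additive monad on `Set`, `A` a set,
`b : A → 2` and `p : A → T A`. Then the map `Φ` on functions `A → T A` defined by
`Φ q x = if b x then (p x >>= q) else ret x` has a least fixed point with respect to
the pointwise induced order, given by
`w x = star (ret x, λx'. (b x')? >>= λ_. p x') >>= λx'. ((¬(b x'))? >>= λ_. ret x')`. -/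
theorem compadd_while_least_fixed_point (M : CompAddMonad) (A : Type)
    (b : A → Unit ⊕ Unit) (p : A → M.T A) (w : A → M.T A)
    (hw : w = fun x =>
      M.bind (M.star (M.ret x) (fun x' => M.bind (M.test (b x')) (fun _ => p x')))
        (fun x' => M.bind (M.test ((b x').swap)) (fun _ => M.ret x'))) :
    (∀ x : A, (match b x with
      | Sum.inl _ => M.bind (p x) w
      | Sum.inr _ => M.ret x) = w x) ∧
    (∀ q : A → M.T A, (∀ x : A, (match b x with
      | Sum.inl _ => M.bind (p x) q
      | Sum.inr _ => M.ret x) = q x) → ∀ x : A, M.le (w x) (q x)) := by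
  have hw' : w = fun x => M.sSup (Set.range fun n => M.whileStep b p n x) := by
    rw [hw]
    funext x
    exact M.sSup_range_bind _ _
  clear hw
  subst hw'
  refine ⟨fun x => ?_, fun q hq x => M.sSup_le _ _ ?_⟩
  · rcases hb : b x with u | u
    · dsimp only
      rw [M.bind_sSup]
      refine M.le_antisymm (M.sSup_le _ _ ?_) (M.sSup_le _ _ ?_)
      · rintro _ ⟨n, rfl⟩
        exact M.le_sSup _ _ ⟨n + 1, M.whileStep_succ_inl p hb n⟩
      · rintro _ ⟨_ | n, rfl⟩
        · dsimp only
          rw [M.whileStep_zero_inl p hb]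
          exact M.bot_le _
        · exact M.le_sSup _ _ ⟨n, (M.whileStep_succ_inl p hb n).symm⟩
    · refine M.le_antisymm (M.le_sSup _ _ ⟨0, M.whileStep_zero_inr p hb⟩) (M.sSup_le _ _ ?_)
      rintro _ ⟨_ | n, rfl⟩ <;> dsimp only
      · rw [M.whileStep_zero_inr p hb]
        exact M.le_refl _
      · rw [M.whileStep_succ_inr p hb]
        exact M.bot_le _
  · rintro _ ⟨n, rfl⟩
    dsimp only
    induction n generalizing x with
    | zero =>
      have hx := hq x
      rcases hb : b x with u | u
      · rw [M.whileStep_zero_inl p hb]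
        exact M.bot_le _
      · simp only [hb] at hx
        rw [M.whileStep_zero_inr p hb, ← hx]
        exact M.le_refl _
    | succ n ih =>
      have hx := hq x
      rcases hb : b x with u | u
      · simp only [hb] at hx
        rw [M.whileStep_succ_inl p hb, ← hx]
        exact M.bind_mono _ ih
      · rw [M.whileStep_succ_inr p hb]
        exact M.bot_le _
end

section
/- Let L be a finitely additive (hence bounded) large Lawvere theory. Then the approximation preorder ⊑ on L coincides with the order ≤ induced by the additive structure (f ≤ g iff f + g = g). -/
/-- A large Lawvere theory: a locally small category whose objects are the (small) sets/types,
with small products, together with a strict product-preserving identity-on-objects functor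
`Set^op → L`.  Products of a small family `m : k → Type` are given strictly on the
set-theoretic coproduct `Σ i, m i`, with projections `[Sigma.mk i]` induced by the
indexing functor `ofFun`. -/
structure LawvereTheory : Type 1 where
  Hom : Type → Type → Type
  id : (n : Type) → Hom n n
  comp : {n m k : Type} → Hom m k → Hom n m → Hom n k
  comp_id : ∀ {n m : Type} (f : Hom n m), comp f (id n) = f
  id_comp : ∀ {n m : Type} (f : Hom n m), comp (id m) f = f
  comp_assoc : ∀ {n m k l : Type} (f : Hom k l) (g : Hom m k) (h : Hom n m),
    comp (comp f g) h = comp f (comp g h)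
  /-- the indexing functor `I : Set^op → L`; for a set-map `e : m → n` we write `[e] : n → m`. -/
  ofFun : {n m : Type} → (m → n) → Hom n m
  ofFun_id : ∀ (n : Type), ofFun (fun x : n => x) = id n
  ofFun_comp : ∀ {n m k : Type} (e : k → m) (e' : m → n),
    ofFun (fun x => e' (e x)) = comp (ofFun e) (ofFun e')
  /-- tupling into the small product `Σ i, m i` of the family `m`. -/
  tuple : {n k : Type} → {m : k → Type} → ((i : k) → Hom n (m i)) → Hom n ((i : k) × m i)
  tuple_proj : ∀ {n k : Type} {m : k → Type} (f : (i : k) → Hom n (m i)) (i : k),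
    comp (ofFun (fun x : m i => Sigma.mk i x)) (tuple f) = f i
  tuple_ext : ∀ {n k : Type} {m : k → Type} (g h : Hom n ((i : k) × m i)),
    (∀ i : k, comp (ofFun (fun x : m i => Sigma.mk i x)) g
      = comp (ofFun (fun x : m i => Sigma.mk i x)) h) → g = h

namespace LawvereTheory

variable (L : LawvereTheory)

/-- `[κ_i] : m → 1`, the `i`-th product projection of `m` viewed as the `m`-fold power of `1`. -/
def proj {m : Type} (i : m) : L.Hom m PUnit :=
  L.ofFun (fun _ => i)

/-- tupling into the power `n × m` (`m`-fold power of `n`, carrier `n × m`). -/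
def tupleR {p n m : Type} (f : m → L.Hom p n) : L.Hom p (n × m) :=
  L.comp (L.ofFun (fun x : n × m => (⟨x.2, x.1⟩ : Σ _ : m, n))) (L.tuple f)

/-- tupling into the power `m × n` (`m`-fold power of `n`, carrier `m × n`). -/
def tupleL {p n m : Type} (f : m → L.Hom p n) : L.Hom p (m × n) :=
  L.comp (L.ofFun (fun x : m × n => (⟨x.1, x.2⟩ : Σ _ : m, n))) (L.tuple f)

/-- `f ⊗ m : n × m → k × m`, the `m`-fold power of `f : n → k`. -/
def tensorR {n k : Type} (f : L.Hom n k) (m : Type) : L.Hom (n × m) (k × m) :=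
  L.tupleR (fun j => L.comp f (L.ofFun (fun x : n => (x, j))))

/-- `m ⊗ f : m × n → m × k`, the `m`-fold power of `f : n → k`. -/
def tensorL (m : Type) {n k : Type} (f : L.Hom n k) : L.Hom (m × n) (m × k) :=
  L.tupleL (fun j => L.comp f (L.ofFun (fun x : n => (j, x))))

/-- the constants of `L`: the elements of `L(0,1)`. -/
def consts : Type := L.Hom PEmpty PUnit

/-- a constant, viewed as a morphism `n → 1` (composition with `[♯] : n → 0`). -/
def toConst {n : Type} (f : L.Hom PEmpty PUnit) : L.Hom n PUnit :=
  L.comp f (L.ofFun (fun x : PEmpty => x.elim))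

/-- `c^n_L : n → n + c_L`, the morphism `[id] × ∏_{f ∈ c_L} f`. -/
def constTuple (n : Type) : L.Hom n (n ⊕ L.consts) :=
  L.comp (L.ofFun (fun i : n ⊕ L.consts => (⟨i, PUnit.unit⟩ : Σ _ : n ⊕ L.consts, PUnit)))
    (L.tuple (fun i : n ⊕ L.consts =>
      match i with
      | Sum.inl i₀ => L.proj i₀
      | Sum.inr f => L.toConst f))

/-- A large Lawvere theory `L` is uniform if every `L`-morphism `f : n → m` has a
generic morphism: some `f̂ : k → 1` and a set-function `u : k × m → n + c_L` with
`f = (f̂ ⊗ m) ∘ [u] ∘ c^n_L` (modulo the identification `1 × m = m`). -/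
def Uniform : Prop :=
  ∀ (n m : Type) (f : L.Hom n m), ∃ (k : Type) (fhat : L.Hom k PUnit)
    (u : k × m → n ⊕ L.consts),
    f = L.comp (L.ofFun (fun j : m => (PUnit.unit, j)))
        (L.comp (L.tensorR fhat m) (L.comp (L.ofFun u) (L.constTuple n)))

/-- `L` is bounded if `|L(0,1)| = 1`. -/
def Bounded : Prop :=
  ∃ c : L.Hom PEmpty PUnit, ∀ d : L.Hom PEmpty PUnit, d = c

end LawvereTheory

/-- A morphism of large Lawvere theories: a functor commuting with the indexing functors
(hence identity on objects and preserving small products). -/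
structure LawvereHom (L₁ L₂ : LawvereTheory) where
  map : {n m : Type} → L₁.Hom n m → L₂.Hom n m
  map_comp : ∀ {n m k : Type} (f : L₁.Hom m k) (g : L₁.Hom n m),
    map (L₁.comp f g) = L₂.comp (map f) (map g)
  map_ofFun : ∀ {n m : Type} (e : m → n), map (L₁.ofFun e) = L₂.ofFun e

namespace LawvereHom

/-- a theory morphism is an isomorphism if it has a two-sided inverse theory morphism. -/
def IsIso {L₁ L₂ : LawvereTheory} (α : LawvereHom L₁ L₂) : Prop :=
  ∃ β : LawvereHom L₂ L₁,
    (∀ (n m : Type) (f : L₁.Hom n m), β.map (α.map f) = f) ∧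
    (∀ (n m : Type) (g : L₂.Hom n m), α.map (β.map g) = g)

/-- faithfulness of a theory morphism. -/
def Faithful {L₁ L₂ : LawvereTheory} (α : LawvereHom L₁ L₂) : Prop :=
  ∀ (n m : Type) (f g : L₁.Hom n m), α.map f = α.map g → f = g

end LawvereHom

/-- The tensor law for a cospan `L₁ → T ← L₂`:
`(σ₁f₁ ⊗ m₂) ∘ (n₁ ⊗ σ₂f₂) = (m₁ ⊗ σ₂f₂) ∘ (σ₁f₁ ⊗ n₂)`. -/
def TensorLaw {L₁ L₂ T : LawvereTheory} (σ₁ : LawvereHom L₁ T) (σ₂ : LawvereHom L₂ T) : Prop :=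
  ∀ (n₁ m₁ n₂ m₂ : Type) (f₁ : L₁.Hom n₁ m₁) (f₂ : L₂.Hom n₂ m₂),
    T.comp (T.tensorR (σ₁.map f₁) m₂) (T.tensorL n₁ (σ₂.map f₂))
      = T.comp (T.tensorL m₁ (σ₂.map f₂)) (T.tensorR (σ₁.map f₁) n₂)

/-- A candidate for the tensor product: a theory with a commuting cospan from `L₁`, `L₂`. -/
structure TensorCandidate (L₁ L₂ : LawvereTheory) where
  T : LawvereTheory
  σ₁ : LawvereHom L₁ T
  σ₂ : LawvereHom L₂ T
  law : TensorLaw σ₁ σ₂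

/-- A tensor candidate is the tensor product `L₁ ⊗ L₂` if it is universal among all
candidates. -/
def IsLawvereTensor {L₁ L₂ : LawvereTheory} (C : TensorCandidate L₁ L₂) : Prop :=
  ∀ D : TensorCandidate L₁ L₂, ∃! α : LawvereHom C.T D.T,
    (∀ (n m : Type) (f : L₁.Hom n m), α.map (C.σ₁.map f) = D.σ₁.map f) ∧
    (∀ (n m : Type) (g : L₂.Hom n m), α.map (C.σ₂.map g) = D.σ₂.map g)

/-! ### Bottom morphisms, approximation, rectangular equivalence, closed sets -/

namespace LawvereTheory

variable (L : LawvereTheory)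

/-- `⊥_{n,m} : n → m`, built from a chosen constant `c = ⊥_{0,1}`:
`⊥_{n,m} = (⊥_{0,1} ⊗ m) ∘ [♯]` (modulo `1 × m = m`, `0 × m = 0`). -/
def botMor (c : L.Hom PEmpty PUnit) (n m : Type) : L.Hom n m :=
  L.comp (L.ofFun (fun j : m => (PUnit.unit, j)))
    (L.comp (L.tensorR c m) (L.ofFun (fun x : PEmpty × m => x.1.elim)))

/-- The approximation preorder `⊑` on the hom-sets of a bounded theory with constant `c`:
the smallest family of preorders with `⊥_{n,m}` as bottom element and closed under the
rule `(π_⊑)` (monotonicity of tupling and composition). -/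
inductive Approx (c : L.Hom PEmpty PUnit) : {n m : Type} → L.Hom n m → L.Hom n m → Prop
  | refl {n m : Type} (f : L.Hom n m) : Approx c f f
  | trans {n m : Type} {f g h : L.Hom n m} :
      Approx c f g → Approx c g h → Approx c f h
  | bot {n m : Type} (f : L.Hom n m) : Approx c (L.botMor c n m) f
  | step {n m k : Type} {f g : L.Hom n m} (h : L.Hom m k) :
      (∀ i : m, Approx c (L.comp (L.proj i) f) (L.comp (L.proj i) g)) →
      Approx c (L.comp h f) (L.comp h g)

section Classical
open Classical in
/-- `δ_{ij} : 1 → 1`: the identity if `i = j`, and `⊥_{1,1}` otherwise. -/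
noncomputable def delta (c : L.Hom PEmpty PUnit) {m : Type} (i j : m) : L.Hom PUnit PUnit :=
  if i = j then L.id PUnit else L.botMor c PUnit PUnit
end Classical

/-- `Δ_i = ∏_j δ_{ij} : m → m`. -/
noncomputable def Delta (c : L.Hom PEmpty PUnit) {m : Type} (i : m) : L.Hom m m :=
  L.comp (L.ofFun (fun j : m => (⟨j, PUnit.unit⟩ : Σ _ : m, PUnit)))
    (L.tuple (fun j : m => L.comp (L.delta c i j) (L.proj j)))

/-- composition of sets of morphisms, `A B = {a ∘ b | a ∈ A, b ∈ B}`. -/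
def setComp {n m k : Type} (C : Set (L.Hom m k)) (A : Set (L.Hom n m)) : Set (L.Hom n k) :=
  {h | ∃ f ∈ C, ∃ g ∈ A, h = L.comp f g}

/-- Rectangular equivalence `≈` on sets of `L`-morphisms: the smallest equivalence
containing `(⊥): {⊥_{n,m}} ≈ ∅` and closed under the rule `(π)`:
if `[κ_i] A ≈ [κ_i] B` for all `i`, then `C A ≈ C B`. -/
inductive RectEq (c : L.Hom PEmpty PUnit) :
    {n m : Type} → Set (L.Hom n m) → Set (L.Hom n m) → Prop
  | refl {n m : Type} (A : Set (L.Hom n m)) : RectEq c A A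
  | symm {n m : Type} {A B : Set (L.Hom n m)} : RectEq c A B → RectEq c B A
  | trans {n m : Type} {A B C : Set (L.Hom n m)} :
      RectEq c A B → RectEq c B C → RectEq c A C
  | bot {n m : Type} : RectEq c {L.botMor c n m} (∅ : Set (L.Hom n m))
  | pi {n m k : Type} {A B : Set (L.Hom n m)} (C : Set (L.Hom m k)) :
      (∀ i : m, RectEq c (L.setComp {L.proj i} A) (L.setComp {L.proj i} B)) →
      RectEq c (L.setComp C A) (L.setComp C B)

/-- rectangular equivalence as a setoid. -/
def rectSetoid (c : L.Hom PEmpty PUnit) (n m : Type) : Setoid (Set (L.Hom n m)) :=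
  ⟨RectEq L c, ⟨fun A => RectEq.refl A, RectEq.symm, RectEq.trans⟩⟩

/-- membership in the closure of a set of morphisms: the smallest set containing `A`,
downward closed under `⊑`, and closed under the rule `(Δ)`. -/
inductive InCl (c : L.Hom PEmpty PUnit) :
    {n k : Type} → Set (L.Hom n k) → L.Hom n k → Prop
  | base {n k : Type} {A : Set (L.Hom n k)} {f : L.Hom n k} : f ∈ A → InCl c A f
  | down {n k : Type} {A : Set (L.Hom n k)} {f g : L.Hom n k} :
      InCl c A g → L.Approx c f g → InCl c A f
  | delta {n k : Type} {A : Set (L.Hom n k)} {m : Type} (g : L.Hom n m) (f : L.Hom m k) :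
      (∀ i : m, InCl c A (L.comp (L.comp f (L.Delta c i)) g)) →
      InCl c A (L.comp f g)

/-- `cl A`: the smallest closed set containing `A`. -/
def cl (c : L.Hom PEmpty PUnit) {n k : Type} (A : Set (L.Hom n k)) : Set (L.Hom n k) :=
  {f | L.InCl c A f}

/-- `IsLUBApprox S h`: `h` is a least upper bound of `S` w.r.t. the approximation
preorder `⊑`. -/
def IsLUBApprox (c : L.Hom PEmpty PUnit) {n k : Type} (S : Set (L.Hom n k))
    (h : L.Hom n k) : Prop :=
  (∀ f ∈ S, L.Approx c f h) ∧ ∀ h', (∀ f ∈ S, L.Approx c f h') → L.Approx c h h'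

/-- `L` is finitary (has rank `ω`) if every morphism into `1` factors through a finite
power of `1`. -/
def Finitary : Prop :=
  ∀ (n : Type) (f : L.Hom n PUnit), ∃ (k : Type) (_ : Finite k) (e : k → n)
    (g : L.Hom k PUnit), f = L.comp g (L.ofFun e)

end LawvereTheory

/-! ### Additive (join-semilattice enriched) structure on theories -/

/-- An enrichment of a large Lawvere theory over join semilattices with bottom:
each hom-set carries binary joins `+` and a bottom `⊥`, and composition preserves
them on both sides. `L` is finitely additive if such a structure exists. -/
structure FinJoinStructure (L : LawvereTheory) where
  join : {n m : Type} → L.Hom n m → L.Hom n m → L.Hom n m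
  bot : (n m : Type) → L.Hom n m
  join_comm : ∀ {n m : Type} (f g : L.Hom n m), join f g = join g f
  join_assoc : ∀ {n m : Type} (f g h : L.Hom n m), join (join f g) h = join f (join g h)
  join_idem : ∀ {n m : Type} (f : L.Hom n m), join f f = f
  bot_join : ∀ {n m : Type} (f : L.Hom n m), join (bot n m) f = f
  comp_join : ∀ {n m k : Type} (f : L.Hom m k) (g h : L.Hom n m),
    L.comp f (join g h) = join (L.comp f g) (L.comp f h)
  join_comp : ∀ {n m k : Type} (f g : L.Hom m k) (h : L.Hom n m),
    L.comp (join f g) h = join (L.comp f h) (L.comp g h)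
  comp_bot : ∀ {n m k : Type} (f : L.Hom m k), L.comp f (bot n m) = bot n k
  bot_comp : ∀ {n m k : Type} (h : L.Hom n m), L.comp (bot m k) h = bot n k

/-- `L` is finitely additive: enriched over join semilattices with bottom. -/
def LawvereTheory.FinitelyAdditive (L : LawvereTheory) : Prop :=
  Nonempty (FinJoinStructure L)

/-- An enrichment of a large Lawvere theory over complete join semilattices (with
bottom `⊥ = ⨆ ∅`): each hom-set is partially ordered with arbitrary joins, and
composition preserves arbitrary joins on both sides.  `L` is completely additive if
such a structure exists. -/
structure CompJoinStructure (L : LawvereTheory) where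
  le : {n m : Type} → L.Hom n m → L.Hom n m → Prop
  le_refl : ∀ {n m : Type} (f : L.Hom n m), le f f
  le_trans : ∀ {n m : Type} {f g h : L.Hom n m}, le f g → le g h → le f h
  le_antisymm : ∀ {n m : Type} {f g : L.Hom n m}, le f g → le g f → f = g
  sSup : {n m : Type} → Set (L.Hom n m) → L.Hom n m
  le_sSup : ∀ {n m : Type} (S : Set (L.Hom n m)) (f : L.Hom n m), f ∈ S → le f (sSup S)
  sSup_le : ∀ {n m : Type} (S : Set (L.Hom n m)) (g : L.Hom n m),
    (∀ f ∈ S, le f g) → le (sSup S) g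
  comp_sSup : ∀ {n m k : Type} (f : L.Hom m k) (S : Set (L.Hom n m)),
    L.comp f (sSup S) = sSup {h | ∃ g ∈ S, h = L.comp f g}
  sSup_comp : ∀ {n m k : Type} (S : Set (L.Hom m k)) (g : L.Hom n m),
    L.comp (sSup S) g = sSup {h | ∃ f ∈ S, h = L.comp f g}

/-- `L` is completely additive: enriched over complete join semilattices. -/
def LawvereTheory.CompletelyAdditive (L : LawvereTheory) : Prop :=
  Nonempty (CompJoinStructure L)

namespace LawvereTheory

variable (L : LawvereTheory)

theorem hom_ext {n m : Type} {f g : L.Hom n m}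
    (h : ∀ i : m, L.comp (L.proj i) f = L.comp (L.proj i) g) : f = g := by
  let e : (Σ _ : m, PUnit) → m := fun x => x.1
  let e' : m → Σ _ : m, PUnit := fun i => ⟨i, PUnit.unit⟩
  have key : L.comp (L.ofFun e) f = L.comp (L.ofFun e) g := by
    apply L.tuple_ext
    intro i
    rw [← L.comp_assoc, ← L.comp_assoc, ← L.ofFun_comp]
    exact h i
  have he : L.comp (L.ofFun e') (L.ofFun e) = L.id m := by
    rw [← L.ofFun_comp, ← L.ofFun_id]
  rw [← L.id_comp f, ← L.id_comp g, ← he, L.comp_assoc, L.comp_assoc, key]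

end LawvereTheory

namespace FinJoinStructure

variable {L : LawvereTheory} (J : FinJoinStructure L)

theorem join_bot {n m : Type} (f : L.Hom n m) : J.join f (J.bot n m) = f := by
  rw [J.join_comm, J.bot_join]

theorem tuple_bot (n k : Type) (m : k → Type) :
    L.tuple (fun i => J.bot n (m i)) = J.bot n (Σ i, m i) := by
  apply L.tuple_ext
  intro i
  rw [L.tuple_proj, J.comp_bot]

theorem botMor_eq_bot (n m : Type) : L.botMor (J.bot PEmpty PUnit) n m = J.bot n m := by
  simp only [LawvereTheory.botMor, LawvereTheory.tensorR, LawvereTheory.tupleR, J.bot_comp,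
    J.tuple_bot, J.comp_bot]

theorem join_eq_of_approx {n m : Type} {f g : L.Hom n m}
    (h : L.Approx (J.bot PEmpty PUnit) f g) : J.join f g = g := by
  induction h with
  | refl f => exact J.join_idem f
  | trans _ _ hfg hgh => rw [← hgh, ← J.join_assoc, hfg]
  | bot f => rw [J.botMor_eq_bot, J.bot_join]
  | step h _ ih =>
    rw [← J.comp_join]
    congr 1
    apply L.hom_ext
    intro i
    rw [J.comp_join, ih i]

theorem bot_approx {n m : Type} (f : L.Hom n m) :
    L.Approx (J.bot PEmpty PUnit) (J.bot n m) f := by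
  rw [← J.botMor_eq_bot n m]
  exact .bot f

theorem approx_join_left {n m : Type} (f g : L.Hom n m) :
    L.Approx (J.bot PEmpty PUnit) f (J.join f g) := by
  let pair (a b : L.Hom n m) : L.Hom n (Σ _ : Bool, m) := L.tuple (fun b' => cond b' a b)
  let codiag : L.Hom (Σ _ : Bool, m) m :=
    J.join (L.ofFun (fun x => ⟨true, x⟩)) (L.ofFun (fun x => ⟨false, x⟩))
  have codiag_pair (a b : L.Hom n m) : L.comp codiag (pair a b) = J.join a b := by
    rw [J.join_comp]
    exact congrArg₂ J.join (L.tuple_proj (fun b' => cond b' a b) true)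
      (L.tuple_proj (fun b' => cond b' a b) false)
  have proj_pair (a b : L.Hom n m) (c : Bool) (i : m) :
      L.comp (L.proj ⟨c, i⟩) (pair a b) = L.comp (L.proj i) (cond c a b) := by
    rw [← L.tuple_proj (fun b' => cond b' a b) c, ← L.comp_assoc]
    unfold LawvereTheory.proj
    rw [← L.ofFun_comp]
  have h : L.Approx (J.bot PEmpty PUnit) (L.comp codiag (pair f (J.bot n m)))
      (L.comp codiag (pair f g)) := by
    apply LawvereTheory.Approx.step
    rintro ⟨_ | _, i⟩
    · rw [proj_pair, proj_pair, cond_false, cond_false, J.comp_bot]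
      exact J.bot_approx _
    · rw [proj_pair, proj_pair]
      exact .refl _
  rwa [codiag_pair, codiag_pair, J.join_bot] at h

end FinJoinStructure

/-- **Statement 9.** Let `L` be a finitely additive (hence bounded) large Lawvere
theory. Then the approximation preorder `⊑` on `L` coincides with the order `≤`
induced by the additive structure (`f ≤ g` iff `f + g = g`). -/
theorem approx_eq_induced_order (L : LawvereTheory) (J : FinJoinStructure L)
    (n m : Type) (f g : L.Hom n m) :
    L.Approx (J.bot PEmpty PUnit) f g ↔ J.join f g = g := by
  refine ⟨J.join_eq_of_approx, fun h => ?_⟩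
  rw [← h]
  exact J.approx_join_left f g
end

section
/- Let L be a bounded large Lawvere theory, let A ⊆ L(n,m), and let a : n → m and b : m → k be L-morphisms. If a ∈ cl(A), then b ∘ a ∈ cl({b ∘ a' | a' ∈ A}). -/
namespace LawvereTheory

variable (L : LawvereTheory)

theorem ofFun_comp_ofFun {n m k : Type} (e : k → m) (e' : m → n) :
    L.comp (L.ofFun e) (L.ofFun e') = L.ofFun (fun x => e' (e x)) :=
  (L.ofFun_comp e e').symm

theorem ofFun_comp_ofFun_assoc {p n m k : Type} (e : k → m) (e' : m → n) (h : L.Hom p n) :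
    L.comp (L.ofFun e) (L.comp (L.ofFun e') h) = L.comp (L.ofFun (fun x => e' (e x))) h := by
  rw [← L.comp_assoc, ofFun_comp_ofFun]

/-- Every component of `⊥_{n,m}` is the constant `⊥_{0,1}`, weakened to `n`. -/
theorem proj_comp_botMor (c : L.Hom PEmpty PUnit) (n : Type) {m : Type} (i : m) :
    L.comp (L.proj i) (L.botMor c n m) = L.toConst c := by
  have hproj : L.comp (L.ofFun (fun _ : PUnit => (PUnit.unit, i))) (L.tensorR c m)
      = L.comp c (L.ofFun (fun x : PEmpty => (x, i))) := by
    unfold tensorR tupleR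
    rw [ofFun_comp_ofFun_assoc]
    exact L.tuple_proj (fun j : m => L.comp c (L.ofFun (fun x : PEmpty => (x, j)))) i
  unfold botMor proj toConst
  rw [ofFun_comp_ofFun_assoc, ← L.comp_assoc, hproj, L.comp_assoc, ofFun_comp_ofFun]

theorem botMor_unit (c : L.Hom PEmpty PUnit) (n : Type) :
    L.botMor c n PUnit = L.toConst c := by
  rw [← L.proj_comp_botMor c n PUnit.unit]
  exact ((congrArg (fun e => L.comp e _) (L.ofFun_id PUnit)).trans (L.id_comp _)).symm

/-- Composition is monotone in its right argument. -/
theorem Approx.comp_left {L : LawvereTheory} {c : L.Hom PEmpty PUnit} {n m k : Type}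
    {f g : L.Hom n m} (hfg : L.Approx c f g) (h : L.Hom m k) :
    L.Approx c (L.comp h f) (L.comp h g) := by
  induction hfg generalizing k with
  | refl f => exact .refl _
  | trans _ _ ih₁ ih₂ => exact (ih₁ h).trans (ih₂ h)
  | bot f =>
    refine .step h fun i => ?_
    rw [proj_comp_botMor, ← botMor_unit]
    exact .bot _
  | step h' hi _ =>
    rw [← L.comp_assoc, ← L.comp_assoc]
    exact .step _ hi

theorem InCl.comp_left {L : LawvereTheory} {c : L.Hom PEmpty PUnit} {n m k : Type}
    {A : Set (L.Hom n m)} {a : L.Hom n m} (ha : L.InCl c A a) (b : L.Hom m k) :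
    L.InCl c {x | ∃ a' ∈ A, x = L.comp b a'} (L.comp b a) := by
  induction ha with
  | base hf => exact .base ⟨_, hf, rfl⟩
  | down _ hfg ih => exact .down ih (hfg.comp_left b)
  | delta g f _ ih =>
    rw [← L.comp_assoc]
    refine .delta g (L.comp b f) fun i => ?_
    simpa only [L.comp_assoc] using ih i

end LawvereTheory

/-- **Statement 13.** Let `L` be a bounded large Lawvere theory, `A ⊆ L(n,m)`, and let
`a : n → m` and `b : m → k` be `L`-morphisms. If `a ∈ cl A`, then
`b ∘ a ∈ cl {b ∘ a' | a' ∈ A}`. -/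
theorem comp_mem_cl (L : LawvereTheory) (c : L.Hom PEmpty PUnit)
    (hc : ∀ d : L.Hom PEmpty PUnit, d = c)
    (n m k : Type) (A : Set (L.Hom n m)) (a : L.Hom n m) (b : L.Hom m k)
    (ha : a ∈ L.cl c A) :
    L.comp b a ∈ L.cl c {x | ∃ a' ∈ A, x = L.comp b a'} :=
  LawvereTheory.InCl.comp_left ha b
end

section
/- Let L₁, L₂, T be large Lawvere theories with morphisms of large Lawvere theories σ₁ : L₁ → T and σ₂ : L₂ → T. If the tensor law holds for all f₁ : n₁ → 1 in L₁ and f₂ : n₂ → 1 in L₂, then it holds for all f₁ : n₁ → m₁ in L₁ and f₂ : n₂ → m₂ in L₂; i.e. the tensor law reduces to the case m₁ = m₂ = 1. -/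
namespace LawvereTheory

variable (L : LawvereTheory)

lemma hom_ext_proj {p m : Type} {g h : L.Hom p m}
    (H : ∀ i : m, L.comp (L.proj i) g = L.comp (L.proj i) h) : g = h := by
  have key : ∀ f : L.Hom p m, L.comp (L.ofFun (fun i : m => (⟨i, PUnit.unit⟩ : Σ _ : m, PUnit)))
      (L.comp (L.ofFun (fun x : (Σ _ : m, PUnit) => x.1)) f) = f := by
    intro f
    rw [← L.comp_assoc, ← L.ofFun_comp, L.ofFun_id, L.id_comp]
  rw [← key g, ← key h]
  congr 1
  refine L.tuple_ext _ _ fun i => ?_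
  rw [← L.comp_assoc, ← L.comp_assoc, ← L.ofFun_comp]
  exact H i

lemma ofFun_comp_tensorR {n k m : Type} (f : L.Hom n k) (j : m) :
    L.comp (L.ofFun (fun x : k => (x, j))) (L.tensorR f m)
      = L.comp f (L.ofFun (fun x : n => (x, j))) := by
  rw [tensorR, tupleR, ← L.comp_assoc, ← L.ofFun_comp]
  exact L.tuple_proj (fun j => L.comp f (L.ofFun (fun x : n => (x, j)))) j

lemma ofFun_comp_tensorL {n k m : Type} (f : L.Hom n k) (i : m) :
    L.comp (L.ofFun (fun x : k => (i, x))) (L.tensorL m f)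
      = L.comp f (L.ofFun (fun x : n => (i, x))) := by
  rw [tensorL, tupleL, ← L.comp_assoc, ← L.ofFun_comp]
  exact L.tuple_proj (fun i => L.comp f (L.ofFun (fun x : n => (i, x)))) i

lemma proj_comp_tensorR {n k m : Type} (f : L.Hom n k) (i : k) (j : m) :
    L.comp (L.proj (i, j)) (L.tensorR f m)
      = L.comp (L.comp (L.proj i) f) (L.ofFun (fun x : n => (x, j))) := by
  rw [L.comp_assoc, ← L.ofFun_comp_tensorR, ← L.comp_assoc]
  congr 1
  exact L.ofFun_comp (fun _ : PUnit => i) (fun x : k => (x, j))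

lemma proj_comp_tensorL {n k m : Type} (f : L.Hom n k) (i : m) (j : k) :
    L.comp (L.proj (i, j)) (L.tensorL m f)
      = L.comp (L.comp (L.proj j) f) (L.ofFun (fun x : n => (i, x))) := by
  rw [L.comp_assoc, ← L.ofFun_comp_tensorL, ← L.comp_assoc]
  congr 1
  exact L.ofFun_comp (fun _ : PUnit => j) (fun x : k => (i, x))

lemma proj_unit : L.proj PUnit.unit = L.id PUnit :=
  L.ofFun_id PUnit

/-- The `j`-th component of `m ⊗ f` depends only on the `j`-th component of `f`. -/
lemma ofFun_comp_tensorL_eq_unary {n k m : Type} (f : L.Hom n k) (j : k) :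
    L.comp (L.ofFun (fun x : m => (x, j))) (L.tensorL m f)
      = L.comp (L.ofFun (fun x : m => (x, PUnit.unit)))
          (L.tensorL m (L.comp (L.proj j) f)) := by
  refine L.hom_ext_proj fun a => ?_
  rw [← L.comp_assoc, ← L.comp_assoc, proj, ← L.ofFun_comp, ← L.ofFun_comp]
  change L.comp (L.proj (a, j)) _ = L.comp (L.proj (a, PUnit.unit)) _
  rw [proj_comp_tensorL, proj_comp_tensorL, proj_unit, L.id_comp]

/-- The `i`-th component of `f ⊗ m` depends only on the `i`-th component of `f`. -/
lemma ofFun_comp_tensorR_eq_unary {n k m : Type} (f : L.Hom n k) (i : k) :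
    L.comp (L.ofFun (fun x : m => (i, x))) (L.tensorR f m)
      = L.comp (L.ofFun (fun x : m => (PUnit.unit, x)))
          (L.tensorR (L.comp (L.proj i) f) m) := by
  refine L.hom_ext_proj fun a => ?_
  rw [← L.comp_assoc, ← L.comp_assoc, proj, ← L.ofFun_comp, ← L.ofFun_comp]
  change L.comp (L.proj (i, a)) _ = L.comp (L.proj (PUnit.unit, a)) _
  rw [proj_comp_tensorR, proj_comp_tensorR, proj_unit, L.id_comp]

lemma proj_comp_tensorR_comp_tensorL {n₁ m₁ n₂ m₂ : Type} (f₁ : L.Hom n₁ m₁) (f₂ : L.Hom n₂ m₂)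
    (i : m₁) (j : m₂) :
    L.comp (L.proj (i, j)) (L.comp (L.tensorR f₁ m₂) (L.tensorL n₁ f₂))
      = L.comp (L.proj (PUnit.unit, PUnit.unit))
          (L.comp (L.tensorR (L.comp (L.proj i) f₁) PUnit)
            (L.tensorL n₁ (L.comp (L.proj j) f₂))) := by
  rw [← L.comp_assoc, ← L.comp_assoc, proj_comp_tensorR, proj_comp_tensorR, proj_unit, L.id_comp,
    L.comp_assoc _ (L.ofFun _), L.comp_assoc _ (L.ofFun _), ofFun_comp_tensorL_eq_unary]

lemma proj_comp_tensorL_comp_tensorR {n₁ m₁ n₂ m₂ : Type} (f₁ : L.Hom n₁ m₁) (f₂ : L.Hom n₂ m₂)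
    (i : m₁) (j : m₂) :
    L.comp (L.proj (i, j)) (L.comp (L.tensorL m₁ f₂) (L.tensorR f₁ n₂))
      = L.comp (L.proj (PUnit.unit, PUnit.unit))
          (L.comp (L.tensorL PUnit (L.comp (L.proj j) f₂))
            (L.tensorR (L.comp (L.proj i) f₁) n₂)) := by
  rw [← L.comp_assoc, ← L.comp_assoc, proj_comp_tensorL, proj_comp_tensorL, proj_unit, L.id_comp,
    L.comp_assoc _ (L.ofFun _), L.comp_assoc _ (L.ofFun _), ofFun_comp_tensorR_eq_unary]

end LawvereTheory

lemma LawvereHom.map_proj_comp {L₁ L₂ : LawvereTheory} (σ : LawvereHom L₁ L₂) {n m : Type}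
    (f : L₁.Hom n m) (i : m) :
    σ.map (L₁.comp (L₁.proj i) f) = L₂.comp (L₂.proj i) (σ.map f) := by
  rw [σ.map_comp, LawvereTheory.proj, σ.map_ofFun, LawvereTheory.proj]

/-- **Statement 18.** The tensor law reduces to the case `m₁ = m₂ = 1`: if it holds
for all `f₁ : n₁ → 1` in `L₁` and `f₂ : n₂ → 1` in `L₂`, then it holds for all
`f₁ : n₁ → m₁` and `f₂ : n₂ → m₂`. -/
theorem tensorLaw_of_unary_case (L₁ L₂ T : LawvereTheory)
    (σ₁ : LawvereHom L₁ T) (σ₂ : LawvereHom L₂ T)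
    (h : ∀ (n₁ n₂ : Type) (f₁ : L₁.Hom n₁ PUnit) (f₂ : L₂.Hom n₂ PUnit),
      T.comp (T.tensorR (σ₁.map f₁) PUnit) (T.tensorL n₁ (σ₂.map f₂))
        = T.comp (T.tensorL PUnit (σ₂.map f₂)) (T.tensorR (σ₁.map f₁) n₂)) :
    TensorLaw σ₁ σ₂ := by
  intro n₁ m₁ n₂ m₂ f₁ f₂
  refine T.hom_ext_proj fun ⟨i, j⟩ => ?_
  rw [T.proj_comp_tensorR_comp_tensorL, T.proj_comp_tensorL_comp_tensorR,
    ← σ₁.map_proj_comp, ← σ₂.map_proj_comp, h]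
end
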